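/- For any two Schwartz functions f, g ∈ 𝒮(ℝ^D, ℂ), the Moyal product f ⋆ g is well defined (the defining double integral converges absolutely for every x) and f ⋆ g is again a Schwartz function, so that (𝒮(ℝ^D, ℂ), ⋆) is closed under the Moyal product. -/

import Mathlib

open MeasureTheory

noncomputable section

/-- The standard symplectic matrix `Σ` on `ℝ^D`: block-diagonal with `D/2` blocks
`((0, -1), (1, 0))`. -/
def stdSigma (D : ℕ) : Matrix (Fin D) (Fin D) ℝ := fun i j =>
  if i.val % 2 = 1 ∧ i.val = j.val + 1 then 1
  else if j.val % 2 = 1 ∧ j.val = i.val + 1 then -1 else 0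

/-- `Θ = θ Σ`. -/
def Theta (θ : ℝ) (D : ℕ) : Matrix (Fin D) (Fin D) ℝ := θ • stdSigma D

/-- `y ∧ z = 2 yᵀ Θ⁻¹ z`. -/
def wedge (θ : ℝ) {D : ℕ} (y z : EuclideanSpace ℝ (Fin D)) : ℝ :=
  2 * ∑ i, ∑ j, y i * (Theta θ D)⁻¹ i j * z j

/-- The Moyal product `(f ⋆ g)(x) = (πθ)^{-D} ∬ f(x+y) g(x+z) e^{-i y∧z} dy dz`. -/
def moyal (θ : ℝ) {D : ℕ} (f g : EuclideanSpace ℝ (Fin D) → ℂ) :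
    EuclideanSpace ℝ (Fin D) → ℂ := fun x =>
  ((Real.pi * θ) ^ D)⁻¹ •
    ∫ p : EuclideanSpace ℝ (Fin D) × EuclideanSpace ℝ (Fin D),
      f (x + p.1) * g (x + p.2) * Complex.exp (-(Complex.I) * (wedge θ p.1 p.2 : ℂ))

open scoped SchwartzMap ContDiff FourierTransform

theorem hasTemperateGrowth_cexp_ofReal_mul_I :
    Function.HasTemperateGrowth (fun t : ℝ => Complex.exp (t * Complex.I)) := by
  have hsmooth : ContDiff ℝ ∞ (fun t : ℝ => Complex.exp (t * Complex.I)) :=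
    (Complex.ofRealCLM.contDiff.mul contDiff_const).cexp
  refine ⟨hsmooth, fun n => ⟨0, 1, fun t => ?_⟩⟩
  have hderiv : ∀ n : ℕ, iteratedDeriv n (fun t : ℝ => Complex.exp (t * Complex.I)) =
      fun t : ℝ => Complex.I ^ n * Complex.exp (t * Complex.I) := by
    intro n
    induction n with
    | zero => simp
    | succ n ih =>
      rw [iteratedDeriv_succ, ih]
      funext t
      have h : HasDerivAt (fun t : ℝ => Complex.exp (t * Complex.I))
          (Complex.exp (t * Complex.I) * (1 * Complex.I)) t :=
        ((Complex.ofRealCLM.hasDerivAt (x := t)).mul_const Complex.I).cexp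
      rw [(h.const_mul (Complex.I ^ n)).deriv]
      ring
  rw [norm_iteratedFDeriv_eq_norm_iteratedDeriv, hderiv]
  simp [Complex.norm_exp_ofReal_mul_I]

namespace SchwartzMap

variable {V E F : Type*} [NormedAddCommGroup V] [NormedSpace ℝ V]
  [NormedAddCommGroup E] [NormedSpace ℝ E] [NormedAddCommGroup F] [NormedSpace ℝ F]

/-- Precomposition with a continuous linear map costs a power of its norm in each derivative. -/
theorem norm_iteratedFDeriv_comp_clm_le (f : 𝓢(E, ℂ)) (A : V →L[ℝ] E) (n : ℕ) (v : V) :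
    ‖iteratedFDeriv ℝ n (fun v => f (A v)) v‖ ≤ ‖iteratedFDeriv ℝ n f (A v)‖ * ‖A‖ ^ n := by
  have h := A.iteratedFDeriv_comp_right (f.smooth n) v le_rfl
  change ‖iteratedFDeriv ℝ n (f ∘ A) v‖ ≤ _
  rw [h]
  refine (ContinuousMultilinearMap.norm_compContinuousLinearMap_le _ _).trans ?_
  simp

theorem exists_mul_decay (f : 𝓢(E, ℂ)) (g : 𝓢(F, ℂ)) (k i j : ℕ) :
    ∃ C : ℝ, ∀ x y, (‖x‖ + ‖y‖) ^ k *
      (‖iteratedFDeriv ℝ i f x‖ * ‖iteratedFDeriv ℝ j g y‖) ≤ C := by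
  obtain ⟨a, ha, hfk⟩ := f.decay k i
  obtain ⟨b, hb, hg0⟩ := g.decay 0 j
  obtain ⟨c, hc, hf0⟩ := f.decay 0 i
  obtain ⟨d, hd, hgk⟩ := g.decay k j
  refine ⟨2 ^ (k - 1) * (a * b + c * d), fun x y => ?_⟩
  have hf0 := hf0 x
  have hg0 := hg0 y
  simp only [pow_zero, one_mul] at hf0 hg0
  calc (‖x‖ + ‖y‖) ^ k * (‖iteratedFDeriv ℝ i f x‖ * ‖iteratedFDeriv ℝ j g y‖)
      ≤ 2 ^ (k - 1) * (‖x‖ ^ k + ‖y‖ ^ k) *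
          (‖iteratedFDeriv ℝ i f x‖ * ‖iteratedFDeriv ℝ j g y‖) := by
        gcongr
        exact add_pow_le (norm_nonneg _) (norm_nonneg _) k
    _ = 2 ^ (k - 1) * ((‖x‖ ^ k * ‖iteratedFDeriv ℝ i f x‖) * ‖iteratedFDeriv ℝ j g y‖ +
          ‖iteratedFDeriv ℝ i f x‖ * (‖y‖ ^ k * ‖iteratedFDeriv ℝ j g y‖)) := by ring
    _ ≤ 2 ^ (k - 1) * (a * b + c * d) := by
        gcongr
        · exact hfk x
        · exact hgk y

/-- The function `v ↦ f (A v) * g (B v)` is Schwartz whenever `A` and `B` jointly control the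
norm. -/
theorem exists_mul_comp_clm (f : 𝓢(E, ℂ)) (g : 𝓢(F, ℂ)) (A : V →L[ℝ] E) (B : V →L[ℝ] F)
    (hAB : ∀ v, ‖v‖ ≤ ‖A v‖ + ‖B v‖) :
    ∃ K : 𝓢(V, ℂ), ∀ v, K v = f (A v) * g (B v) := by
  have hf : ContDiff ℝ ∞ (fun v => f (A v)) := (f.smooth ⊤).comp A.contDiff
  have hg : ContDiff ℝ ∞ (fun v => g (B v)) := (g.smooth ⊤).comp B.contDiff
  refine ⟨⟨fun v => f (A v) * g (B v), hf.mul hg, fun k n => ?_⟩, fun v => rfl⟩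
  choose C hC using fun i => exists_mul_decay f g k i (n - i)
  refine ⟨∑ i ∈ Finset.range (n + 1), n.choose i * (‖A‖ ^ i * ‖B‖ ^ (n - i)) * C i, fun v => ?_⟩
  calc ‖v‖ ^ k * ‖iteratedFDeriv ℝ n (fun v => f (A v) * g (B v)) v‖
      ≤ (‖A v‖ + ‖B v‖) ^ k * ∑ i ∈ Finset.range (n + 1), (n.choose i : ℝ) *
          ‖iteratedFDeriv ℝ i (fun v => f (A v)) v‖ *
          ‖iteratedFDeriv ℝ (n - i) (fun v => g (B v)) v‖ := by
        gcongr
        · exact hAB v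
        · exact norm_iteratedFDeriv_mul_le hf hg v (mod_cast le_top)
    _ ≤ (‖A v‖ + ‖B v‖) ^ k * ∑ i ∈ Finset.range (n + 1), (n.choose i : ℝ) *
          (‖iteratedFDeriv ℝ i f (A v)‖ * ‖A‖ ^ i) *
          (‖iteratedFDeriv ℝ (n - i) g (B v)‖ * ‖B‖ ^ (n - i)) := by
        gcongr
        · exact norm_iteratedFDeriv_comp_clm_le f A _ v
        · exact norm_iteratedFDeriv_comp_clm_le g B _ v
    _ = ∑ i ∈ Finset.range (n + 1), n.choose i * (‖A‖ ^ i * ‖B‖ ^ (n - i)) *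
          ((‖A v‖ + ‖B v‖) ^ k *
            (‖iteratedFDeriv ℝ i f (A v)‖ * ‖iteratedFDeriv ℝ (n - i) g (B v)‖)) := by
        rw [Finset.mul_sum]
        exact Finset.sum_congr rfl fun i _ => by ring
    _ ≤ _ := by
        gcongr with i
        exact hC i _ _

end SchwartzMap

section TwistedProduct

variable {E : Type*} [NormedAddCommGroup E] [InnerProductSpace ℝ E]

/-- The twisted tensor product `(y, z) ↦ f(y) g(z) e^{-2i⟨y, Nz⟩}` is Schwartz. -/
theorem SchwartzMap.exists_twisted_tensor (N : E →L[ℝ] E) (f g : 𝓢(E, ℂ)) :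
    ∃ K : 𝓢(WithLp 2 (E × E), ℂ), ∀ p, K p = f p.fst * g p.snd *
      Complex.exp (((-2 * inner ℝ p.fst (N p.snd) : ℝ) : ℂ) * Complex.I) := by
  obtain ⟨K, hK⟩ := SchwartzMap.exists_mul_comp_clm f g
    (WithLp.fstL 2 ℝ E E) (WithLp.sndL 2 ℝ E E) (fun v => by
      change ‖v‖ ≤ ‖v.fst‖ + ‖v.snd‖
      rw [← sq_le_sq₀ (norm_nonneg _) (by positivity), WithLp.prod_norm_sq_eq_of_L2, add_sq]
      linarith [mul_nonneg (norm_nonneg v.fst) (norm_nonneg v.snd)])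
  have hphase : Function.HasTemperateGrowth (fun p : WithLp 2 (E × E) =>
      -2 * (inner ℝ p.fst (N p.snd) : ℝ)) :=
    (Function.HasTemperateGrowth.const (-2)).mul
      ((innerSL ℝ).bilinear_hasTemperateGrowth
        (WithLp.fstL 2 ℝ E E).hasTemperateGrowth
        (N.comp (WithLp.sndL 2 ℝ E E)).hasTemperateGrowth)
  have hexp := hasTemperateGrowth_cexp_ofReal_mul_I.comp hphase
  refine ⟨SchwartzMap.smulLeftCLM ℂ
    ((fun t : ℝ => Complex.exp (t * Complex.I)) ∘ fun p : WithLp 2 (E × E) =>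
      -2 * (inner ℝ p.fst (N p.snd) : ℝ)) K, fun p => ?_⟩
  rw [SchwartzMap.smulLeftCLM_apply_apply hexp, hK, smul_eq_mul, mul_comm]
  rfl

/-- A twisted product with nondegenerate skew phase is a Fourier transform on the doubled space,
restricted to an embedded copy of the original space. -/
theorem SchwartzMap.twisted_product [FiniteDimensional ℝ E] [MeasurableSpace E] [BorelSpace E]
    (N : E →L[ℝ] E) (hN : Function.Injective N) (hskew : ∀ y z, inner ℝ y (N z) = -inner ℝ z (N y))
    (f g : 𝓢(E, ℂ)) :
    (∀ x : E, Integrable (fun p : E × E => f (x + p.1) * g (x + p.2) *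
      Complex.exp (-Complex.I * ((2 * inner ℝ p.1 (N p.2) : ℝ) : ℂ)))) ∧
    ∃ h : 𝓢(E, ℂ), ∀ x, h x = ∫ p : E × E, f (x + p.1) * g (x + p.2) *
      Complex.exp (-Complex.I * ((2 * inner ℝ p.1 (N p.2) : ℝ) : ℂ)) := by
  obtain ⟨K, hK⟩ := SchwartzMap.exists_twisted_tensor N f g
  let L : E →L[ℝ] WithLp 2 (E × E) :=
    (WithLp.prodContinuousLinearEquiv 2 ℝ E E).symm.toContinuousLinearMap.comp
      ((-Real.pi⁻¹ • N).prod (Real.pi⁻¹ • N))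
  have hLsnd : ∀ x, (L x).snd = Real.pi⁻¹ • N x := fun _ => rfl
  have hLinj : Function.Injective L := fun x y hxy => by
    have h := congrArg WithLp.snd hxy
    rw [hLsnd, hLsnd] at h
    exact hN (smul_right_injective E (inv_ne_zero Real.pi_ne_zero) h)
  obtain ⟨c, -, hc⟩ := L.toLinearMap.exists_antilipschitzWith (LinearMap.ker_eq_bot.2 hLinj)
  have hxx : ∀ x, inner ℝ x (N x) = (0 : ℝ) := fun x => by linarith [hskew x x]
  let G : E → WithLp 2 (E × E) → ℂ := fun x v =>
    Complex.exp (((-2 * Real.pi * inner ℝ v (L x) : ℝ) : ℂ) * Complex.I) • K v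
  have hG : ∀ (x : E), (fun p : E × E => f (x + p.1) * g (x + p.2) *
      Complex.exp (-Complex.I * ((2 * inner ℝ p.1 (N p.2) : ℝ) : ℂ))) =
      fun p => G x (WithLp.toLp 2 ((x, x) + p)) := by
    intro x
    funext p
    have hphase : -(2 * inner ℝ p.1 (N p.2) : ℝ) =
        -2 * Real.pi * inner ℝ (WithLp.toLp 2 ((x, x) + p)) (L x) +
          -2 * inner ℝ (x + p.1) (N (x + p.2)) := by
      rw [WithLp.prod_inner_apply]
      change _ = -2 * Real.pi * (inner ℝ (x + p.1) (-Real.pi⁻¹ • N x) +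
        inner ℝ (x + p.2) (Real.pi⁻¹ • N x)) + _
      simp only [inner_smul_right, inner_add_left, inner_add_right, map_add, hxx]
      rw [hskew p.2 x]
      field_simp
      ring
    have hexp : Complex.exp (-Complex.I * ((2 * inner ℝ p.1 (N p.2) : ℝ) : ℂ)) =
        Complex.exp (((-2 * Real.pi * inner ℝ (WithLp.toLp 2 ((x, x) + p)) (L x) : ℝ) : ℂ) *
          Complex.I) *
        Complex.exp (((-2 * inner ℝ (x + p.1) (N (x + p.2)) : ℝ) : ℂ) * Complex.I) := by
      rw [← Complex.exp_add, ← add_mul, ← Complex.ofReal_add, ← hphase, Complex.ofReal_neg]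
      congr 1
      ring
    simp only [G]
    rw [hexp, hK, smul_eq_mul]
    exact mul_left_comm _ _ _
  have hGint : ∀ x, Integrable (G x) := fun x => by
    have h := (Real.fourierIntegral_convergent_iff (L x)).2 (K.integrable (μ := volume))
    refine h.congr (Filter.Eventually.of_forall fun v => ?_)
    simp only [G, Circle.smul_def, Real.fourierChar_apply, mul_neg, neg_mul]
  have hmp := WithLp.volume_preserving_toLp E E
  have hemb : MeasurableEmbedding (WithLp.toLp 2 : E × E → WithLp 2 (E × E)) :=
    (MeasurableEquiv.toLp 2 (E × E)).measurableEmbedding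
  have : (volume : Measure (E × E)).IsAddLeftInvariant :=
    inferInstanceAs ((volume : Measure E).prod (volume : Measure E)).IsAddLeftInvariant
  refine ⟨fun x => ?_, SchwartzMap.compCLMOfAntilipschitz ℂ L.hasTemperateGrowth hc (𝓕 K),
    fun x => ?_⟩
  · rw [hG]
    exact ((hmp.integrable_comp_emb hemb).2 (hGint x)).comp_add_left (x, x)
  · rw [hG, integral_add_left_eq_self (fun p => G x (WithLp.toLp 2 p)) (x, x),
      hmp.integral_comp hemb]
    simp only [SchwartzMap.compCLMOfAntilipschitz_apply, Function.comp_apply,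
      SchwartzMap.fourier_coe]
    rw [Real.fourier_eq']

end TwistedProduct

section Symplectic

theorem stdSigma_transpose (D : ℕ) : (stdSigma D).transpose = -stdSigma D := by
  ext i j
  simp only [Matrix.transpose_apply, Matrix.neg_apply, stdSigma]
  split_ifs <;> first | omega | simp

theorem stdSigma_mul_self {D : ℕ} (hD : Even D) : stdSigma D * stdSigma D = -1 := by
  obtain ⟨m, hm⟩ := hD
  ext i j
  rw [Matrix.mul_apply]
  have hi := i.isLt
  rcases Nat.mod_two_eq_zero_or_one i.val with h | h
  · rw [Finset.sum_eq_single (⟨i + 1, by omega⟩ : Fin D)]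
    · simp only [stdSigma, Matrix.neg_apply, Matrix.one_apply, Fin.ext_iff]
      split_ifs <;> first | omega | (simp; done) | simp_all
    · intro b _ hb
      simp only [ne_eq, Fin.ext_iff] at hb
      simp only [stdSigma]
      split_ifs <;> first | omega | simp
    · simp
  · rw [Finset.sum_eq_single (⟨i - 1, by omega⟩ : Fin D)]
    · simp only [stdSigma, Matrix.neg_apply, Matrix.one_apply, Fin.ext_iff]
      split_ifs <;> first | omega | simp
    · intro b _ hb
      simp only [ne_eq, Fin.ext_iff] at hb
      simp only [stdSigma]
      split_ifs <;> first | omega | simp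
    · simp

theorem Theta_mul_neg_inv_smul {D : ℕ} (hD : Even D) {θ : ℝ} (hθ : θ ≠ 0) :
    Theta θ D * -(θ⁻¹ • stdSigma D) = 1 := by
  rw [Theta, mul_neg, Matrix.smul_mul, Matrix.mul_smul, smul_smul, mul_inv_cancel₀ hθ, one_smul,
    stdSigma_mul_self hD, neg_neg]

theorem Theta_inv {D : ℕ} (hD : Even D) {θ : ℝ} (hθ : θ ≠ 0) :
    (Theta θ D)⁻¹ = -(θ⁻¹ • stdSigma D) :=
  Matrix.inv_eq_right_inv (Theta_mul_neg_inv_smul hD hθ)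

theorem wedge_eq_inner (θ : ℝ) {D : ℕ} (y z : EuclideanSpace ℝ (Fin D)) :
    wedge θ y z = 2 * inner ℝ y (Matrix.toEuclideanCLM (𝕜 := ℝ) (Theta θ D)⁻¹ z) := by
  rw [Matrix.inner_toEuclideanCLM]
  simp only [wedge, dotProduct, Matrix.mulVec, Finset.mul_sum, mul_assoc]

end Symplectic

/-- for Schwartz `f, g`, the Moyal product is well defined (the defining
double integral converges absolutely for every `x`) and is again a Schwartz function. -/
theorem moyal_schwartz (D : ℕ) (hD : 0 < D) (hDeven : Even D) (θ : ℝ) (hθ : 0 < θ)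
    (f g : SchwartzMap (EuclideanSpace ℝ (Fin D)) ℂ) :
    (∀ x : EuclideanSpace ℝ (Fin D),
      Integrable (fun p : EuclideanSpace ℝ (Fin D) × EuclideanSpace ℝ (Fin D) =>
        f (x + p.1) * g (x + p.2) * Complex.exp (-(Complex.I) * (wedge θ p.1 p.2 : ℂ)))) ∧
    ∃ h : SchwartzMap (EuclideanSpace ℝ (Fin D)) ℂ,
      ∀ x, h x = moyal θ (⇑f) (⇑g) x := by
  let N := Matrix.toEuclideanCLM (n := Fin D) (𝕜 := ℝ) (Theta θ D)⁻¹
  have hinv := Theta_inv hDeven hθ.ne'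
  have hN : Function.Injective N := by
    have hleft : Theta θ D * (Theta θ D)⁻¹ = 1 := by
      rw [hinv, Theta_mul_neg_inv_smul hDeven hθ.ne']
    refine Function.LeftInverse.injective
      (g := Matrix.toEuclideanCLM (n := Fin D) (𝕜 := ℝ) (Theta θ D)) fun x => ?_
    rw [← mul_apply_eq_comp, ← map_mul, hleft, map_one]
    rfl
  have hskew : ∀ y z, inner ℝ y (N z) = -inner ℝ z (N y) := fun y z => by
    have ht : (Theta θ D)⁻¹.transpose = -(Theta θ D)⁻¹ := by
      rw [hinv, Matrix.transpose_neg, Matrix.transpose_smul, stdSigma_transpose, smul_neg]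
    rw [Matrix.inner_toEuclideanCLM, Matrix.inner_toEuclideanCLM, Matrix.dotProduct_mulVec,
      ← Matrix.mulVec_transpose, ht, Matrix.neg_mulVec, neg_dotProduct, dotProduct_comm]
  obtain ⟨hint, h, hh⟩ := SchwartzMap.twisted_product N hN hskew f g
  simp only [moyal, wedge_eq_inner]
  exact ⟨hint, ((Real.pi * θ) ^ D)⁻¹ • h, fun x => by rw [smul_apply, hh]⟩
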